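/- arXiv:1509.05598 — 5 statements merged into one kernel-verified Lean document; each statement's English description precedes it below -/
import Mathlib

section
/- Let x : [t₀,∞) → H be a solution of x''(t) + γ(t)·x'(t) + ∇Φ(x(t)) = 0, let x* ∈ argmin Φ, and set h(t) = ½‖x(t) − x*‖². Then the energy W(t) = ½‖x'(t)‖² + Φ(x(t)) − min Φ satisfies W(t) ≤ (3/2)·‖x'(t)‖² − h''(t) − γ(t)·h'(t) for all t ≥ t₀. -/
open Filter MeasureTheory Set

/-- The gradient inequality: a differentiable convex function lies above its tangent planes. -/
theorem ConvexOn.add_inner_gradient_le {E : Type*} [NormedAddCommGroup E] [InnerProductSpace ℝ E]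
    [CompleteSpace E] {f : E → ℝ} (hf : ConvexOn ℝ Set.univ f) {a : E}
    (hd : DifferentiableAt ℝ f a) (b : E) : f a + inner ℝ (gradient f a) (b - a) ≤ f b := by
  have hline : ConvexOn ℝ Set.univ (f ∘ AffineMap.lineMap (k := ℝ) a b) := by
    simpa using hf.comp_affineMap (AffineMap.lineMap (k := ℝ) a b)
  have hfd : HasFDerivAt f (InnerProductSpace.toDual ℝ E (gradient f a))
      (AffineMap.lineMap (k := ℝ) a b 0) := by
    simpa using hd.hasGradientAt.hasFDerivAt
  have hderiv := hfd.comp_hasDerivAt (0 : ℝ) AffineMap.hasDerivAt_lineMap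
  have hslope := hline.le_slope_of_hasDerivAt (mem_univ 0) (mem_univ 1) zero_lt_one hderiv
  simp only [slope_def_field, Function.comp_apply, AffineMap.lineMap_apply_one,
    AffineMap.lineMap_apply_zero, InnerProductSpace.toDual_apply_apply, sub_zero, div_one] at hslope
  linarith

/-- with `h(t) = ½‖x(t) − x*‖²`, the energy satisfies
`W(t) ≤ (3/2)‖x'(t)‖² − h''(t) − γ(t) h'(t)` for all `t ≥ t₀`. -/
theorem stmt_5 {H : Type*} [NormedAddCommGroup H] [InnerProductSpace ℝ H] [CompleteSpace H]
    (Φ : H → ℝ) (hconv : ConvexOn ℝ Set.univ Φ) (hdiff : ContDiff ℝ 1 Φ)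
    (t₀ : ℝ) (ht₀ : 0 < t₀)
    (γ : ℝ → ℝ) (hγc : ContinuousOn γ (Set.Ici t₀))
    (x x' x'' : ℝ → H)
    (hx' : ∀ t ∈ Set.Ici t₀, HasDerivWithinAt x (x' t) (Set.Ici t₀) t)
    (hx'' : ∀ t ∈ Set.Ici t₀, HasDerivWithinAt x' (x'' t) (Set.Ici t₀) t)
    (hx''c : ContinuousOn x'' (Set.Ici t₀))
    (heq : ∀ t ∈ Set.Ici t₀, x'' t + γ t • x' t + gradient Φ (x t) = 0)
    (xstar : H) (hxstar : ∀ y, Φ xstar ≤ Φ y)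
    (h h' h'' : ℝ → ℝ) (hh : ∀ t, h t = 1 / 2 * ‖x t - xstar‖ ^ 2)
    (hh' : ∀ t ∈ Set.Ici t₀, HasDerivWithinAt h (h' t) (Set.Ici t₀) t)
    (hh'' : ∀ t ∈ Set.Ici t₀, HasDerivWithinAt h' (h'' t) (Set.Ici t₀) t)
    (W : ℝ → ℝ) (hW : ∀ t, W t = 1 / 2 * ‖x' t‖ ^ 2 + Φ (x t) - Φ xstar) :
    ∀ t ∈ Set.Ici t₀, W t ≤ 3 / 2 * ‖x' t‖ ^ 2 - h'' t - γ t * h' t := by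
  intro t ht
  have huniq := uniqueDiffOn_Ici t₀
  have hh'_eq : ∀ s ∈ Set.Ici t₀, h' s = inner ℝ (x s - xstar) (x' s) := by
    intro s hs
    have hd := ((hx' s hs).sub_const xstar).norm_sq.const_mul (1 / 2 : ℝ)
    rw [(huniq s hs).eq_deriv _ (hh' s hs) (hd.congr (fun r _ => hh r) (hh s))]
    ring
  have hh''_eq : h'' t = inner ℝ (x t - xstar) (x'' t) + ‖x' t‖ ^ 2 := by
    have hd := ((hx' t ht).sub_const xstar).inner ℝ (hx'' t ht)
    rw [(huniq t ht).eq_deriv _ (hh'' t ht) (hd.congr hh'_eq (hh'_eq t ht)),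
      real_inner_self_eq_norm_sq]
  have hgrad := hconv.add_inner_gradient_le (hdiff.differentiable one_ne_zero (x t)) xstar
  have hode := congrArg (inner ℝ (x t - xstar)) (heq t ht)
  rw [inner_add_right, inner_add_right, inner_smul_right, inner_zero_right] at hode
  rw [real_inner_comm, ← neg_sub (x t) xstar, inner_neg_left] at hgrad
  rw [hW, hh''_eq, hh'_eq t ht]
  linarith
end

section
/- Let γ : [t₀,∞) → ℝ be continuously differentiable with γ(t) ≥ K/t for all t ≥ t₀, K > 3, and ∫_{t₀}^{∞} max((t·γ(t))', 0) dt < +∞. Let x : [t₀,∞) → H solve x''(t) + γ(t)·x'(t) + ∇Φ(x(t)) = 0. Then sup_{t ≥ t₀} t²·W(t) < +∞, where W(t) = ½‖x'(t)‖² + Φ(x(t)) − min Φ. -/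
open Filter MeasureTheory Set

/-- A differentiable convex function lies above its tangent hyperplanes. -/
theorem ConvexOn.sub_le_inner_gradient {H : Type*} [NormedAddCommGroup H] [InnerProductSpace ℝ H]
    [CompleteSpace H] {Φ : H → ℝ} (hconv : ConvexOn ℝ Set.univ Φ) {x : H}
    (hdiff : DifferentiableAt ℝ Φ x) (y : H) :
    Φ x - Φ y ≤ inner ℝ (x - y) (gradient Φ x) := by
  have hline : ConvexOn ℝ Set.univ (Φ ∘ AffineMap.lineMap (k := ℝ) x y) := by
    simpa using hconv.comp_affineMap (AffineMap.lineMap (k := ℝ) x y)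
  have hd : HasDerivAt (Φ ∘ AffineMap.lineMap (k := ℝ) x y)
      (inner ℝ (gradient Φ x) (y - x)) (0 : ℝ) := by
    have hΦ : HasFDerivAt Φ (InnerProductSpace.toDual ℝ H (gradient Φ x))
        (AffineMap.lineMap (k := ℝ) x y (0 : ℝ)) := by
      simpa using hdiff.hasGradientAt.hasFDerivAt
    simpa using hΦ.comp_hasDerivAt (0 : ℝ) AffineMap.hasDerivAt_lineMap
  have h := hline.le_slope_of_hasDerivAt (mem_univ 0) (mem_univ 1) zero_lt_one hd
  simp only [slope_def_field, Function.comp_apply, AffineMap.lineMap_apply_one,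
    AffineMap.lineMap_apply_zero, sub_zero, div_one] at h
  rw [real_inner_comm, ← neg_sub y x, inner_neg_right]
  linarith

/-- Grönwall's inequality on a half-line with an integrable rate. -/
theorem le_mul_exp_integral_of_deriv_le_mul {E E' q : ℝ → ℝ} {a : ℝ}
    (hE : ∀ t ∈ Ici a, HasDerivWithinAt E (E' t) (Ici a) t)
    (hq : ContinuousOn q (Ici a)) (hq0 : ∀ t ∈ Ici a, 0 ≤ q t) (hqi : IntegrableOn q (Ici a))
    (hE0 : 0 ≤ E a) (hle : ∀ t ∈ Ici a, E' t ≤ q t * E t) {t : ℝ} (ht : t ∈ Ici a) :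
    E t ≤ E a * Real.exp (∫ s in Ici a, q s) := by
  have hqc : Continuous (fun s => q (max s a)) :=
    hq.comp_continuous (continuous_id.max continuous_const) fun s => le_max_right s a
  set Q : ℝ → ℝ := fun s => ∫ r in a..s, q (max r a) with hQ
  have hQd (s : ℝ) : HasDerivAt Q (q (max s a)) s :=
    intervalIntegral.integral_hasDerivAt_right (hqc.intervalIntegrable _ _)
      (hqc.stronglyMeasurableAtFilter _ _) hqc.continuousAt
  have hd (s : ℝ) (hs : s ∈ Ici a) : HasDerivWithinAt (fun r => E r * Real.exp (-Q r))
      ((E' s - q s * E s) * Real.exp (-Q s)) (Ici a) s := by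
    refine ((hE s hs).mul (hQd s).neg.exp.hasDerivWithinAt).congr_deriv ?_
    rw [max_eq_left (mem_Ici.1 hs), Pi.neg_apply]
    ring
  have hanti : AntitoneOn (fun r => E r * Real.exp (-Q r)) (Ici a) := by
    refine antitoneOn_of_hasDerivWithinAt_nonpos (convex_Ici a)
      (fun s hs => (hd s hs).continuousWithinAt)
      (fun s hs => (hd s (interior_subset hs)).mono interior_subset) fun s hs => ?_
    exact mul_nonpos_of_nonpos_of_nonneg (sub_nonpos.2 (hle s (interior_subset hs)))
      (Real.exp_pos _).le
  have hQt : Q t ≤ ∫ s in Ici a, q s := by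
    have : Q t = ∫ s in Ioc a t, q s := by
      rw [hQ]
      simp only
      rw [intervalIntegral.integral_of_le ht]
      exact setIntegral_congr_fun measurableSet_Ioc fun s hs => by
        simp only [max_eq_left hs.1.le]
    rw [this]
    exact setIntegral_mono_set hqi ((ae_restrict_iff' measurableSet_Ici).2 (ae_of_all _ hq0))
      (Ioc_subset_Ioi_self.trans Ioi_subset_Ici_self).eventuallyLE
  have h := hanti self_mem_Ici ht ht
  simp only [hQ, intervalIntegral.integral_same, neg_zero, Real.exp_zero, mul_one] at h
  calc E t = E t * Real.exp (-Q t) * Real.exp (Q t) := by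
        rw [mul_assoc, ← Real.exp_add, neg_add_cancel, Real.exp_zero, mul_one]
    _ ≤ E a * Real.exp (Q t) := mul_le_mul_of_nonneg_right h (Real.exp_pos _).le
    _ ≤ _ := mul_le_mul_of_nonneg_left (Real.exp_le_exp.2 hQt) hE0

/-- Derivative of the Lyapunov function of the damped inertial system `x'' + γ x' + ∇Φ(x) = 0`. -/
theorem hasDerivWithinAt_lyapunov {H : Type*} [NormedAddCommGroup H] [InnerProductSpace ℝ H]
    [CompleteSpace H] {Φ : H → ℝ} {γ : ℝ → ℝ} {x x' : ℝ → H} {x'' xstar : H} {γ' m t : ℝ}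
    {s : Set ℝ} (hΦ : DifferentiableAt ℝ Φ (x t)) (hγ : HasDerivWithinAt γ γ' s t)
    (hx : HasDerivWithinAt x (x' t) s t) (hx' : HasDerivWithinAt x' x'' s t)
    (heq : x'' + γ t • x' t + gradient Φ (x t) = 0) :
    HasDerivWithinAt (fun r => r ^ 2 * (Φ (x r) - m)
        + 1 / 2 * ‖(2 : ℝ) • (x r - xstar) + r • x' r‖ ^ 2
        + (r * γ r - 3) * ‖x r - xstar‖ ^ 2)
      (2 * t * (Φ (x t) - m) - 2 * t * inner ℝ (x t - xstar) (gradient Φ (x t))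
        - t * (t * γ t - 3) * ‖x' t‖ ^ 2 + (γ t + t * γ') * ‖x t - xstar‖ ^ 2) s t := by
  have hid := hasDerivWithinAt_id t s
  have hΦx : HasDerivWithinAt (fun r => Φ (x r)) (inner ℝ (gradient Φ (x t)) (x' t)) s t := by
    exact (hΦ.hasGradientAt.hasFDerivAt.comp_hasDerivWithinAt t hx).congr_deriv
      (InnerProductSpace.toDual_apply_apply ..)
  have hu := hx.sub_const xstar
  have hv := (hu.const_smul (2 : ℝ)).add (hid.smul hx')
  have h := (((hid.pow 2).mul (hΦx.sub_const m)).add (hv.norm_sq.const_mul (1 / 2))).add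
    (((hid.mul hγ).sub_const 3).mul hu.norm_sq)
  have hx''e : x'' = -(γ t • x' t) - gradient Φ (x t) := by
    rw [eq_sub_iff_add_eq, ← sub_eq_zero, ← heq]
    abel
  refine h.congr_deriv ?_
  simp only [hx''e, id, Pi.add_apply, Pi.smul_apply, Pi.smul_apply', Pi.pow_apply, Pi.mul_apply]
  generalize x t - xstar = u
  simp only [← real_inner_self_eq_norm_sq, inner_add_left, inner_add_right, inner_sub_right,
    inner_neg_right, real_inner_smul_left, real_inner_smul_right]
  rw [real_inner_comm (x' t) (gradient Φ (x t))]
  push_cast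
  ring

/-- under the general damping hypotheses, `sup_{t ≥ t₀} t² W(t) < ∞`. -/
theorem stmt_8 {H : Type*} [NormedAddCommGroup H] [InnerProductSpace ℝ H] [CompleteSpace H]
    (Φ : H → ℝ) (hconv : ConvexOn ℝ Set.univ Φ) (hdiff : ContDiff ℝ 1 Φ)
    (t₀ K : ℝ) (ht₀ : 0 < t₀) (hK : 3 < K)
    (xstar : H) (hxstar : ∀ y, Φ xstar ≤ Φ y)
    (γ γ' : ℝ → ℝ)
    (hγ' : ∀ t ∈ Set.Ici t₀, HasDerivWithinAt γ (γ' t) (Set.Ici t₀) t)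
    (hγ'c : ContinuousOn γ' (Set.Ici t₀))
    (hγK : ∀ t ∈ Set.Ici t₀, K / t ≤ γ t)
    (hγint : MeasureTheory.IntegrableOn (fun t => max (γ t + t * γ' t) 0) (Set.Ici t₀))
    (x x' x'' : ℝ → H)
    (hx' : ∀ t ∈ Set.Ici t₀, HasDerivWithinAt x (x' t) (Set.Ici t₀) t)
    (hx'' : ∀ t ∈ Set.Ici t₀, HasDerivWithinAt x' (x'' t) (Set.Ici t₀) t)
    (hx''c : ContinuousOn x'' (Set.Ici t₀))
    (heq : ∀ t ∈ Set.Ici t₀, x'' t + γ t • x' t + gradient Φ (x t) = 0)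
    (W : ℝ → ℝ) (hW : ∀ t, W t = 1 / 2 * ‖x' t‖ ^ 2 + Φ (x t) - Φ xstar) :
    ∃ C : ℝ, ∀ t ∈ Set.Ici t₀, t ^ 2 * W t ≤ C := by
  set E : ℝ → ℝ := fun r => r ^ 2 * (Φ (x r) - Φ xstar)
    + 1 / 2 * ‖(2 : ℝ) • (x r - xstar) + r • x' r‖ ^ 2 + (r * γ r - 3) * ‖x r - xstar‖ ^ 2 with hE
  set q : ℝ → ℝ := fun t => max (γ t + t * γ' t) 0
  have hK3 : 0 < K - 3 := sub_pos.2 hK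
  have hpos (t : ℝ) (ht : t ∈ Ici t₀) : 0 < t := ht₀.trans_le ht
  have hp (t : ℝ) (ht : t ∈ Ici t₀) : K - 3 ≤ t * γ t - 3 := by
    have := (div_le_iff₀' (hpos t ht)).1 (hγK t ht)
    linarith
  have hdist (t : ℝ) (ht : t ∈ Ici t₀) : (K - 3) * ‖x t - xstar‖ ^ 2 ≤ E t := by
    have h1 := mul_le_mul_of_nonneg_right (hp t ht) (sq_nonneg ‖x t - xstar‖)
    have h2 := mul_nonneg (sq_nonneg t) (sub_nonneg.2 (hxstar (x t)))
    have h3 := sq_nonneg ‖(2 : ℝ) • (x t - xstar) + t • x' t‖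
    simp only [hE]
    linarith
  have hγc : ContinuousOn γ (Ici t₀) := fun t ht => (hγ' t ht).continuousWithinAt
  have hqc : ContinuousOn q (Ici t₀) :=
    ContinuousOn.sup (hγc.add (continuousOn_id.mul hγ'c)) continuousOn_const
  have hbound (t : ℝ) (ht : t ∈ Ici t₀) :
      E t ≤ E t₀ * Real.exp (∫ s in Ici t₀, q s / (K - 3)) := by
    refine le_mul_exp_integral_of_deriv_le_mul
      (fun s hs => hasDerivWithinAt_lyapunov (hdiff.differentiable one_ne_zero _) (hγ' s hs)
        (hx' s hs) (hx'' s hs) (heq s hs))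
      (hqc.div_const _) (fun s _ => div_nonneg (le_max_right _ _) hK3.le) (hγint.div_const _)
      ((mul_nonneg hK3.le (sq_nonneg _)).trans (hdist t₀ self_mem_Ici)) (fun s hs => ?_) ht
    have h1 : 2 * s * (Φ (x s) - Φ xstar) ≤
        2 * s * inner ℝ (x s - xstar) (gradient Φ (x s)) :=
      mul_le_mul_of_nonneg_left
        (hconv.sub_le_inner_gradient (hdiff.differentiable one_ne_zero _) xstar)
        (by linarith [hpos s hs])
    have h2 : 0 ≤ s * (s * γ s - 3) * ‖x' s‖ ^ 2 :=
      mul_nonneg (mul_nonneg (hpos s hs).le (hK3.le.trans (hp s hs))) (sq_nonneg _)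
    have h3 : (γ s + s * γ' s) * ‖x s - xstar‖ ^ 2 ≤ q s * ‖x s - xstar‖ ^ 2 :=
      mul_le_mul_of_nonneg_right (le_max_left _ _) (sq_nonneg _)
    have h4 : q s * ‖x s - xstar‖ ^ 2 ≤ q s / (K - 3) * E s := by
      rw [div_mul_eq_mul_div, le_div_iff₀ hK3, mul_assoc, mul_comm _ (K - 3)]
      exact mul_le_mul_of_nonneg_left (hdist s hs) (le_max_right _ _)
    refine le_trans ?_ h4
    linarith
  set M := E t₀ * Real.exp (∫ s in Ici t₀, q s / (K - 3))
  refine ⟨3 * M + 4 * (M / (K - 3)), fun t ht => ?_⟩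
  have hu : ‖x t - xstar‖ ^ 2 ≤ M / (K - 3) :=
    (le_div_iff₀' hK3).2 ((hdist t ht).trans (hbound t ht))
  have hv : t ^ 2 * ‖x' t‖ ^ 2 ≤
      2 * ‖(2 : ℝ) • (x t - xstar) + t • x' t‖ ^ 2 + 8 * ‖x t - xstar‖ ^ 2 := by
    have h := norm_sub_le ((2 : ℝ) • (x t - xstar) + t • x' t) ((2 : ℝ) • (x t - xstar))
    rw [add_sub_cancel_left, norm_smul, norm_smul, Real.norm_of_nonneg (hpos t ht).le,
      Real.norm_of_nonneg zero_le_two] at h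
    have h' := pow_le_pow_left₀ (mul_nonneg (hpos t ht).le (norm_nonneg _)) h 2
    nlinarith [sq_nonneg (‖(2 : ℝ) • (x t - xstar) + t • x' t‖ - 2 * ‖x t - xstar‖)]
  have hM := hbound t ht
  simp only [hE] at hM
  have h1 := mul_nonneg (hK3.le.trans (hp t ht)) (sq_nonneg ‖x t - xstar‖)
  have h2 := mul_nonneg (sq_nonneg t) (sub_nonneg.2 (hxstar (x t)))
  have h3 := sq_nonneg ‖(2 : ℝ) • (x t - xstar) + t • x' t‖
  rw [hW]
  linarith
end

section
/- Let x : [t₀,∞) → H be a solution of x''(t) + γ(t)·x'(t) + ∇Φ(x(t)) = 0, let x* ∈ argmin Φ, and set h(t) = ½‖x(t) − x*‖². Then h''(t) + γ(t)·h'(t) ≤ ‖x'(t)‖² for all t ≥ t₀. -/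
open Filter MeasureTheory Set

/-- First-order inequality for a convex function on a Hilbert space. -/
theorem ConvexOn.inner_gradient_sub_le {H : Type*} [NormedAddCommGroup H] [InnerProductSpace ℝ H]
    [CompleteSpace H] {Φ : H → ℝ} (hconv : ConvexOn ℝ Set.univ Φ) {u : H}
    (hdiff : DifferentiableAt ℝ Φ u) (v : H) :
    inner ℝ (gradient Φ u) (v - u) ≤ Φ v - Φ u := by
  have hg : ConvexOn ℝ Set.univ (Φ ∘ AffineMap.lineMap (k := ℝ) u v) := by
    simpa using hconv.comp_affineMap (AffineMap.lineMap (k := ℝ) u v)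
  have hΦ : HasFDerivAt Φ (InnerProductSpace.toDual ℝ H (gradient Φ u))
      (AffineMap.lineMap (k := ℝ) u v 0) := by
    simpa using hdiff.hasGradientAt.hasFDerivAt
  have hd := hΦ.comp_hasDerivAt (0 : ℝ) AffineMap.hasDerivAt_lineMap
  have := hg.le_slope_of_hasDerivAt (Set.mem_univ 0) (Set.mem_univ 1) one_pos hd
  simpa [slope_def_field] using this

/-- with `h(t) = ½‖x(t) − x*‖²`, one has
`h''(t) + γ(t) h'(t) ≤ ‖x'(t)‖²` for all `t ≥ t₀`. -/
theorem stmt_11 {H : Type*} [NormedAddCommGroup H] [InnerProductSpace ℝ H] [CompleteSpace H]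
    (Φ : H → ℝ) (hconv : ConvexOn ℝ Set.univ Φ) (hdiff : ContDiff ℝ 1 Φ)
    (t₀ : ℝ) (ht₀ : 0 < t₀)
    (γ : ℝ → ℝ) (hγc : ContinuousOn γ (Set.Ici t₀))
    (x x' x'' : ℝ → H)
    (hx' : ∀ t ∈ Set.Ici t₀, HasDerivWithinAt x (x' t) (Set.Ici t₀) t)
    (hx'' : ∀ t ∈ Set.Ici t₀, HasDerivWithinAt x' (x'' t) (Set.Ici t₀) t)
    (hx''c : ContinuousOn x'' (Set.Ici t₀))
    (heq : ∀ t ∈ Set.Ici t₀, x'' t + γ t • x' t + gradient Φ (x t) = 0)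
    (xstar : H) (hxstar : ∀ y, Φ xstar ≤ Φ y)
    (h h' h'' : ℝ → ℝ) (hh : ∀ t, h t = 1 / 2 * ‖x t - xstar‖ ^ 2)
    (hh' : ∀ t ∈ Set.Ici t₀, HasDerivWithinAt h (h' t) (Set.Ici t₀) t)
    (hh'' : ∀ t ∈ Set.Ici t₀, HasDerivWithinAt h' (h'' t) (Set.Ici t₀) t) :
    ∀ t ∈ Set.Ici t₀, h'' t + γ t * h' t ≤ ‖x' t‖ ^ 2 := by
  intro t ht
  have hu : UniqueDiffOn ℝ (Set.Ici t₀) := uniqueDiffOn_Ici t₀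
  have hh'_eq : ∀ s ∈ Set.Ici t₀, h' s = inner ℝ (x s - xstar) (x' s) := by
    intro s hs
    have hd := (((hx' s hs).sub_const xstar).norm_sq.const_mul (1 / 2 : ℝ)).congr
      (fun r _ => hh r) (hh s)
    rw [(hu s hs).eq_deriv _ (hh' s hs) hd]
    ring
  have hh''_eq : h'' t = inner ℝ (x t - xstar) (x'' t) + ‖x' t‖ ^ 2 := by
    have hd := (((hx' t ht).sub_const xstar).inner ℝ (hx'' t ht)).congr hh'_eq (hh'_eq t ht)
    rw [(hu t ht).eq_deriv _ (hh'' t ht) hd, real_inner_self_eq_norm_sq]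
  have hgrad := hconv.inner_gradient_sub_le (hdiff.differentiable one_ne_zero (x t)) xstar
  have hmin := hxstar (x t)
  have hinner := congrArg (inner ℝ (x t - xstar)) (heq t ht)
  rw [inner_add_right, inner_add_right, real_inner_smul_right, inner_zero_right] at hinner
  rw [real_inner_comm, ← neg_sub (x t) xstar, inner_neg_left] at hgrad
  rw [hh''_eq, hh'_eq t ht]
  linarith
end

section
/- Let γ : [t₀,∞) → ℝ be continuous with γ(t) ≥ K/t for all t ≥ t₀, K > 3. Let x : [t₀,∞) → H solve x''(t) + γ(t)·x'(t) + ∇Φ(x(t)) = 0 and assume ∫_{t₀}^{∞} τ·‖x'(τ)‖² dτ < +∞. Then for every x* ∈ argmin Φ, with h(t) = ½‖x(t) − x*‖², one has ∫_{t₀}^{∞} max(h'(t), 0) dt ≤ (t₀·|h'(t₀)|)/(K−1) + (1/(K−1))·∫_{t₀}^{∞} τ·‖x'(τ)‖² dτ < +∞, and consequently lim_{t→+∞} ‖x(t) − x*‖ exists. -/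
open Filter MeasureTheory Set

/-- First-order monotonicity of a convex function with respect to a minimizer. -/
theorem ConvexOn.inner_sub_gradient_nonneg_of_forall_le {H : Type*} [NormedAddCommGroup H]
    [InnerProductSpace ℝ H] [CompleteSpace H] {Φ : H → ℝ} (hconv : ConvexOn ℝ Set.univ Φ)
    {z y : H} (hdiff : DifferentiableAt ℝ Φ y) (hz : ∀ w, Φ z ≤ Φ w) :
    0 ≤ inner ℝ (y - z) (gradient Φ y) := by
  have hφ : ConvexOn ℝ Set.univ (Φ ∘ AffineMap.lineMap (k := ℝ) y z) :=
    hconv.comp_affineMap (AffineMap.lineMap (k := ℝ) y z)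
  have hgrad : HasFDerivAt Φ (InnerProductSpace.toDual ℝ H (gradient Φ y))
      (AffineMap.lineMap (k := ℝ) y z 0) := by
    simpa using hdiff.hasGradientAt.hasFDerivAt
  have hderiv := hgrad.comp_hasDerivAt (0 : ℝ) AffineMap.hasDerivAt_lineMap
  have hle := hφ.le_slope_of_hasDerivAt (Set.mem_univ 0) (Set.mem_univ 1) one_pos hderiv
  have hmin := hz y
  simp only [slope_def_field, Function.comp_apply, AffineMap.lineMap_apply_one,
    AffineMap.lineMap_apply_zero, InnerProductSpace.toDual_apply_apply, sub_zero, div_one] at hle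
  rw [real_inner_comm, ← neg_sub z y, inner_neg_right]
  linarith

/-- The right derivative of the positive part of a right-differentiable function. -/
theorem HasDerivWithinAt.max_zero_Ioi {v : ℝ → ℝ} {v' t : ℝ}
    (hv : HasDerivWithinAt v v' (Set.Ioi t) t) :
    HasDerivWithinAt (fun s => max (v s) 0)
      (if 0 < v t then v' else if v t < 0 then 0 else max v' 0) (Set.Ioi t) t := by
  have hcont : Tendsto v (nhdsWithin t (Set.Ioi t)) (nhds (v t)) := hv.continuousWithinAt
  split_ifs with hpos hneg
  · refine hv.congr_of_eventuallyEq ?_ (max_eq_left hpos.le)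
    filter_upwards [hcont.eventually_const_lt hpos] with s hs using max_eq_left hs.le
  · refine (hasDerivWithinAt_const t (Set.Ioi t) (0 : ℝ)).congr_of_eventuallyEq ?_
      (max_eq_right hneg.le)
    filter_upwards [hcont.eventually_lt_const hneg] with s hs using max_eq_right hs.le
  · have hzero : v t = 0 := le_antisymm (not_lt.mp hpos) (not_lt.mp hneg)
    rw [hasDerivWithinAt_iff_tendsto_slope' Set.self_notMem_Ioi] at hv ⊢
    refine (hv.max tendsto_const_nhds).congr' ?_
    filter_upwards [self_mem_nhdsWithin] with s hs
    have hst : 0 < s - t := sub_pos.mpr hs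
    simp only [slope_def_field, hzero, max_self, sub_zero]
    rw [max_div_div_right hst.le (v s) 0 |>.symm, zero_div]

/-- If `v' ≤ g - (K / t) v` wherever `v ≥ 0`, then integrating the derivative of `t ↦ t v(t)₊`
controls the integral of the positive part of `v`. -/
theorem integral_max_zero_le_of_hasDerivWithinAt {a b K : ℝ} (ha : 0 < a) (hab : a ≤ b)
    (hK : 1 < K) {v v' g : ℝ → ℝ}
    (hv : ∀ t ∈ Set.Ici a, HasDerivWithinAt v (v' t) (Set.Ici a) t)
    (hgc : ContinuousOn g (Set.Ici a)) (hg : ∀ t ∈ Set.Ici a, 0 ≤ g t)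
    (hle : ∀ t ∈ Set.Ici a, 0 ≤ v t → v' t ≤ g t - K / t * v t) :
    ∫ t in a..b, max (v t) 0 ≤
      a * |v a| / (K - 1) + (1 / (K - 1)) * ∫ t in a..b, t * g t := by
  have hvc : ContinuousOn v (Set.Ici a) := fun t ht => (hv t ht).continuousWithinAt
  have huc : ContinuousOn (fun t => max (v t) 0) (Set.Icc a b) :=
    (hvc.sup continuousOn_const).mono Set.Icc_subset_Ici_self
  have hgc' : ContinuousOn (fun t => t * g t) (Set.Icc a b) :=
    (continuousOn_id.mul hgc).mono Set.Icc_subset_Ici_self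
  have hright : ∀ t ∈ Set.Ioo a b, HasDerivWithinAt (fun s => s * max (v s) 0)
      (1 * max (v t) 0 + t * (if 0 < v t then v' t else if v t < 0 then 0 else max (v' t) 0))
      (Set.Ioi t) t := fun t ht =>
    (hasDerivWithinAt_id t (Set.Ioi t)).mul ((hv t ht.1.le).mono
      (Set.Ioi_subset_Ici ht.1.le)).max_zero_Ioi
  have hbound : ∀ t ∈ Set.Ioo a b,
      1 * max (v t) 0 + t * (if 0 < v t then v' t else if v t < 0 then 0 else max (v' t) 0) ≤
        t * g t - (K - 1) * max (v t) 0 := by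
    intro t ht
    have ht0 : 0 < t := ha.trans ht.1
    have hg0 := hg t ht.1.le
    have hlet := hle t ht.1.le
    split_ifs with hpos hneg
    · have := mul_le_mul_of_nonneg_left (hlet hpos.le) ht0.le
      have hcancel : t * (g t - K / t * v t) = t * g t - K * v t := by field_simp
      rw [max_eq_left hpos.le]
      linarith
    · rw [max_eq_right hneg.le]
      have := mul_nonneg ht0.le hg0
      linarith
    · have hzero : v t = 0 := le_antisymm (not_lt.mp hpos) (not_lt.mp hneg)
      have hv' : v' t ≤ g t := by simpa [hzero] using hlet hzero.ge
      have := mul_le_mul_of_nonneg_left (max_le hv' hg0) ht0.le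
      simp only [hzero, max_self]
      linarith
  have hmain : b * max (v b) 0 - a * max (v a) 0 ≤
      ∫ t in a..b, (t * g t - (K - 1) * max (v t) 0) :=
    intervalIntegral.sub_le_integral_of_hasDeriv_right_of_le hab
    (continuousOn_id.mul huc) hright
    (hgc'.sub (continuousOn_const.mul huc)).integrableOn_Icc hbound
  rw [intervalIntegral.integral_sub (hgc'.intervalIntegrable_of_Icc hab)
    ((huc.intervalIntegrable_of_Icc hab).const_mul (K - 1)),
    intervalIntegral.integral_const_mul] at hmain
  have hb0 : 0 ≤ b * max (v b) 0 := mul_nonneg (ha.le.trans hab) (le_max_right _ _)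
  have ha0 : a * max (v a) 0 ≤ a * |v a| :=
    mul_le_mul_of_nonneg_left (max_le (le_abs_self _) (abs_nonneg _)) ha.le
  have hK0 : 0 < K - 1 := sub_pos.mpr hK
  rw [one_div_mul_eq_div, ← add_div, le_div_iff₀ hK0]
  linarith

/-- A nonnegative function whose derivative has integrable positive part converges at infinity. -/
theorem exists_tendsto_atTop_of_integrableOn_max_zero {a : ℝ} {f f' : ℝ → ℝ}
    (hf : ∀ t ∈ Set.Ici a, HasDerivWithinAt f (f' t) (Set.Ici a) t)
    (hf0 : ∀ t ∈ Set.Ici a, 0 ≤ f t)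
    (hint : IntegrableOn (fun t => max (f' t) 0) (Set.Ici a)) :
    ∃ L : ℝ, Tendsto f atTop (nhds L) := by
  have hii : ∀ s ∈ Set.Ici a, ∀ t ∈ Set.Ici a,
      IntervalIntegrable (fun t => max (f' t) 0) volume s t := fun s hs t ht =>
    (hint.mono_set (Set.ordConnected_Ici.uIcc_subset hs ht)).intervalIntegrable
  have hint' : IntegrableOn (fun t => max (f' t) 0) (Set.Ioi a) :=
    hint.mono_set Set.Ioi_subset_Ici_self
  have htend := intervalIntegral_tendsto_integral_Ioi a hint' tendsto_id
  have hanti : Antitone fun t => f (max t a) - ∫ s in a..(max t a), max (f' s) 0 := by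
    intro s t hst
    have hs : a ≤ max s a := le_max_right _ _
    have ht : a ≤ max t a := le_max_right _ _
    have hst' : max s a ≤ max t a := max_le_max_right a hst
    have hincr := intervalIntegral.sub_le_integral_of_hasDeriv_right_of_le hst'
      (fun r hr => ((hf r (hs.trans hr.1)).continuousWithinAt).mono
        (Set.Icc_subset_Ici_self.trans (Set.Ici_subset_Ici.mpr hs)))
      (fun r hr => (hf r (hs.trans hr.1.le)).mono (Set.Ioi_subset_Ici (hs.trans hr.1.le)))
      (hint.mono_set (Set.Icc_subset_Ici_self.trans (Set.Ici_subset_Ici.mpr hs)))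
      (fun r _ => le_max_left (f' r) 0)
    have hadd := intervalIntegral.integral_add_adjacent_intervals
      (hii a Set.self_mem_Ici _ hs) (hii _ hs _ ht)
    simp only
    linarith
  have hbdd : BddBelow (Set.range fun t =>
      f (max t a) - ∫ s in a..(max t a), max (f' s) 0) := by
    refine ⟨-∫ s in Set.Ioi a, max (f' s) 0, ?_⟩
    rintro _ ⟨t, rfl⟩
    have hnonneg := hf0 (max t a) (Set.mem_Ici.mpr (le_max_right _ _))
    have hle : ∫ s in a..(max t a), max (f' s) 0 ≤ ∫ s in Set.Ioi a, max (f' s) 0 := by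
      rw [intervalIntegral.integral_of_le (le_max_right _ _)]
      exact setIntegral_mono_set hint' (Eventually.of_forall fun s => le_max_right _ _)
        Set.Ioc_subset_Ioi_self.eventuallyLE
    simp only
    linarith
  refine ⟨_, ((tendsto_atTop_ciInf hanti hbdd).add htend).congr' ?_⟩
  filter_upwards [eventually_ge_atTop a] with t ht
  simp [max_eq_left ht]

/-- if `γ(t) ≥ K/t` with `K > 3` and `∫ τ‖x'(τ)‖² dτ < ∞`, then for every
minimizer `x*`, with `h(t) = ½‖x(t) − x*‖²`, the positive part of `h'` is integrable with
`∫ [h']₊ ≤ t₀|h'(t₀)|/(K−1) + (1/(K−1)) ∫ τ‖x'(τ)‖² dτ`, and `lim_{t→∞} ‖x(t) − x*‖` exists. -/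
theorem stmt_14 {H : Type*} [NormedAddCommGroup H] [InnerProductSpace ℝ H] [CompleteSpace H]
    (Φ : H → ℝ) (hconv : ConvexOn ℝ Set.univ Φ) (hdiff : ContDiff ℝ 1 Φ)
    (t₀ K : ℝ) (ht₀ : 0 < t₀) (hK : 3 < K)
    (γ : ℝ → ℝ) (hγc : ContinuousOn γ (Set.Ici t₀))
    (hγK : ∀ t ∈ Set.Ici t₀, K / t ≤ γ t)
    (x x' x'' : ℝ → H)
    (hx' : ∀ t ∈ Set.Ici t₀, HasDerivWithinAt x (x' t) (Set.Ici t₀) t)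
    (hx'' : ∀ t ∈ Set.Ici t₀, HasDerivWithinAt x' (x'' t) (Set.Ici t₀) t)
    (hx''c : ContinuousOn x'' (Set.Ici t₀))
    (heq : ∀ t ∈ Set.Ici t₀, x'' t + γ t • x' t + gradient Φ (x t) = 0)
    (hxint : MeasureTheory.IntegrableOn (fun τ => τ * ‖x' τ‖ ^ 2) (Set.Ici t₀))
    (xstar : H) (hxstar : ∀ y, Φ xstar ≤ Φ y)
    (h h' : ℝ → ℝ) (hh : ∀ t, h t = 1 / 2 * ‖x t - xstar‖ ^ 2)
    (hh' : ∀ t ∈ Set.Ici t₀, HasDerivWithinAt h (h' t) (Set.Ici t₀) t) :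
    MeasureTheory.IntegrableOn (fun t => max (h' t) 0) (Set.Ici t₀) ∧
    (∫ t in Set.Ici t₀, max (h' t) 0) ≤
      t₀ * |h' t₀| / (K - 1) +
        (1 / (K - 1)) * ∫ τ in Set.Ici t₀, τ * ‖x' τ‖ ^ 2 ∧
    ∃ L : ℝ, Filter.Tendsto (fun t => ‖x t - xstar‖) Filter.atTop (nhds L) := by
  have hx'c : ContinuousOn x' (Set.Ici t₀) := fun t ht => (hx'' t ht).continuousWithinAt
  have hsub : ∀ t ∈ Set.Ici t₀,
      HasDerivWithinAt (fun s => x s - xstar) (x' t) (Set.Ici t₀) t := fun t ht =>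
    (hx' t ht).sub_const xstar
  have hh'eq : ∀ t ∈ Set.Ici t₀, h' t = inner ℝ (x t - xstar) (x' t) := by
    intro t ht
    have hderiv : HasDerivWithinAt h (1 / 2 * (2 * inner ℝ (x t - xstar) (x' t)))
        (Set.Ici t₀) t := by
      rw [show h = fun s => 1 / 2 * ‖x s - xstar‖ ^ 2 from funext hh]
      exact (hsub t ht).norm_sq.const_mul (1 / 2)
    have := (uniqueDiffOn_Ici t₀ t ht).eq_deriv _ (hh' t ht) hderiv
    linarith
  have hh'' : ∀ t ∈ Set.Ici t₀, HasDerivWithinAt h'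
      (inner ℝ (x t - xstar) (x'' t) + inner ℝ (x' t) (x' t)) (Set.Ici t₀) t := fun t ht =>
    ((hsub t ht).inner ℝ (hx'' t ht)).congr hh'eq (hh'eq t ht)
  have hode : ∀ t ∈ Set.Ici t₀, 0 ≤ h' t →
      inner ℝ (x t - xstar) (x'' t) + inner ℝ (x' t) (x' t) ≤ ‖x' t‖ ^ 2 - K / t * h' t := by
    intro t ht hpos
    have hgrad := hconv.inner_sub_gradient_nonneg_of_forall_le
      (hdiff.differentiable one_ne_zero (x t)) hxstar
    have hinner := congrArg (inner ℝ (x t - xstar)) (heq t ht)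
    rw [inner_add_right, inner_add_right, inner_smul_right, inner_zero_right,
      ← hh'eq t ht] at hinner
    have hdamp := mul_le_mul_of_nonneg_right (hγK t ht) hpos
    rw [real_inner_self_eq_norm_sq]
    linarith
  have hxint' : IntegrableOn (fun τ => τ * ‖x' τ‖ ^ 2) (Set.Ioi t₀) :=
    hxint.mono_set Set.Ioi_subset_Ici_self
  have hK1 : 0 < K - 1 := by linarith
  have hbound : ∀ b, t₀ ≤ b → ∫ t in t₀..b, max (h' t) 0 ≤
      t₀ * |h' t₀| / (K - 1) + (1 / (K - 1)) * ∫ τ in Set.Ioi t₀, τ * ‖x' τ‖ ^ 2 := by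
    intro b hb
    refine (integral_max_zero_le_of_hasDerivWithinAt ht₀ hb (by linarith) hh''
      (hx'c.norm.pow 2) (fun t _ => sq_nonneg _) hode).trans ?_
    gcongr
    rw [intervalIntegral.integral_of_le hb]
    refine setIntegral_mono_set hxint' ?_ Set.Ioc_subset_Ioi_self.eventuallyLE
    filter_upwards [ae_restrict_mem measurableSet_Ioi] with t ht
    exact mul_nonneg (ht₀.trans ht).le (sq_nonneg _)
  have hposc : ContinuousOn (fun t => max (h' t) 0) (Set.Ici t₀) :=
    ContinuousOn.sup (fun t ht => (hh'' t ht).continuousWithinAt) continuousOn_const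
  have hposint : IntegrableOn (fun t => max (h' t) 0) (Set.Ioi t₀) := by
    refine integrableOn_Ioi_of_intervalIntegral_norm_bounded
      (t₀ * |h' t₀| / (K - 1) + (1 / (K - 1)) * ∫ τ in Set.Ioi t₀, τ * ‖x' τ‖ ^ 2) t₀ (fun b => ?_) tendsto_id
      ((eventually_ge_atTop t₀).mono fun b hb => ?_) (l := atTop)
    · exact ((hposc.mono Set.Icc_subset_Ici_self).integrableOn_Icc).mono_set
        Set.Ioc_subset_Icc_self
    · simpa only [Real.norm_of_nonneg (le_max_right (h' _) 0), id_eq] using hbound b hb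
  have hposint' : IntegrableOn (fun t => max (h' t) 0) (Set.Ici t₀) :=
    Iff.mpr integrableOn_Ici_iff_integrableOn_Ioi hposint
  refine ⟨hposint', ?_, ?_⟩
  · rw [integral_Ici_eq_integral_Ioi, integral_Ici_eq_integral_Ioi]
    exact le_of_tendsto (intervalIntegral_tendsto_integral_Ioi t₀ hposint tendsto_id)
      ((eventually_ge_atTop t₀).mono hbound)
  · obtain ⟨L, hL⟩ := exists_tendsto_atTop_of_integrableOn_max_zero hh'
      (fun t _ => by rw [hh]; positivity) hposint'
    refine ⟨√(2 * L), (hL.const_mul 2).sqrt.congr fun t => ?_⟩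
    rw [hh, ← mul_assoc, mul_one_div_cancel two_ne_zero, one_mul, Real.sqrt_sq (norm_nonneg _)]
end

section
/- Let γ : [t₀,∞) → ℝ be continuously differentiable with γ(t) ≥ K/t for all t ≥ t₀, K > 3, and ∫_{t₀}^{∞} max((t·γ(t))', 0) dt < +∞. Let x : [t₀,∞) → H solve x''(t) + γ(t)·x'(t) + ∇Φ(x(t)) = 0. Then Φ(x(t)) → min Φ and ‖x'(t)‖ → 0 as t → +∞. -/
open Filter MeasureTheory Set

/-- The first-order convexity inequality: a differentiable convex function lies above its tangent
hyperplanes. -/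
theorem ConvexOn.inner_gradient_le {H : Type*} [NormedAddCommGroup H] [InnerProductSpace ℝ H]
    [CompleteSpace H] {Φ : H → ℝ} (hconv : ConvexOn ℝ Set.univ Φ) {x : H}
    (hdiff : DifferentiableAt ℝ Φ x) (y : H) :
    inner ℝ (gradient Φ x) (y - x) ≤ Φ y - Φ x := by
  have hline : ConvexOn ℝ Set.univ (Φ ∘ AffineMap.lineMap (k := ℝ) x y) := by
    simpa using hconv.comp_affineMap (AffineMap.lineMap (k := ℝ) x y)
  have hderiv : HasDerivAt (Φ ∘ AffineMap.lineMap (k := ℝ) x y)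
      (inner ℝ (gradient Φ x) (y - x)) 0 := by
    have h := hdiff.hasGradientAt.hasFDerivAt.comp_hasDerivAt_of_eq (0 : ℝ)
      (AffineMap.hasDerivAt_lineMap (a := x) (b := y)) (by simp)
    simpa using h
  simpa [slope_def_field] using
    hline.le_slope_of_hasDerivAt (Set.mem_univ 0) (Set.mem_univ 1) one_pos hderiv

/-- Grönwall's inequality on a half-line, with an integrable rate. -/
theorem le_mul_exp_integral_of_hasDerivWithinAt_le {E E' g : ℝ → ℝ} {a : ℝ}
    (hE : ∀ t ∈ Ici a, HasDerivWithinAt E (E' t) (Ici a) t)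
    (hg : ContinuousOn g (Ici a)) (hg_nonneg : ∀ t ∈ Ici a, 0 ≤ g t)
    (hg_int : IntegrableOn g (Ici a)) (hle : ∀ t ∈ Ici a, E' t ≤ g t * E t)
    (hEa : 0 ≤ E a) {t : ℝ} (ht : t ∈ Ici a) :
    E t ≤ E a * Real.exp (∫ s in Ici a, g s) := by
  set G : ℝ → ℝ := fun t => ∫ s in a..t, g (max s a) with hG
  have hcont : Continuous fun s => g (max s a) :=
    hg.comp_continuous (by fun_prop) fun s => le_max_right s a
  have hGderiv : ∀ t ∈ Ici a, HasDerivAt G (g t) t := fun t ht => by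
    simpa [max_eq_left (mem_Ici.mp ht)] using (hcont.integral_hasStrictDerivAt a t).hasDerivAt
  have hFderiv : ∀ t ∈ Ici a, HasDerivWithinAt (fun t => E t * Real.exp (-G t))
      (E' t * Real.exp (-G t) + E t * (Real.exp (-G t) * -g t)) (Ici a) t := fun t ht =>
    (hE t ht).mul (hGderiv t ht).hasDerivWithinAt.neg.exp
  have hanti : AntitoneOn (fun t => E t * Real.exp (-G t)) (Ici a) := by
    refine antitoneOn_of_hasDerivWithinAt_nonpos (convex_Ici a)
      (fun t ht => (hFderiv t ht).continuousWithinAt)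
      (fun t ht => (hFderiv t (interior_subset ht)).mono interior_subset) fun t ht => ?_
    nlinarith [hle t (interior_subset ht), Real.exp_pos (-G t)]
  have hFt : E t * Real.exp (-G t) ≤ E a := by
    simpa [hG] using hanti self_mem_Ici ht ht
  have hGt : G t ≤ ∫ s in Ici a, g s := by
    have hGeq : G t = ∫ s in Ioc a t, g s := by
      rw [hG]
      simp only [intervalIntegral.integral_of_le (mem_Ici.mp ht)]
      exact setIntegral_congr_fun measurableSet_Ioc fun s hs => by
        simp [max_eq_left hs.1.le]
    rw [hGeq]
    exact setIntegral_mono_set hg_int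
      (ae_restrict_of_forall_mem measurableSet_Ici hg_nonneg)
      (Ioc_subset_Ioi_self.trans Ioi_subset_Ici_self).eventuallyLE
  calc E t = E t * Real.exp (-G t) * Real.exp (G t) := by
        rw [mul_assoc, ← Real.exp_add]; simp
    _ ≤ E a * Real.exp (G t) := by gcongr
    _ ≤ E a * Real.exp (∫ s in Ici a, g s) := by gcongr

/-- The derivative of the Lyapunov energy along a trajectory of `x'' + γ x' + ∇Φ(x) = 0`. -/
theorem hasDerivWithinAt_inertial_energy {H : Type*} [NormedAddCommGroup H]
    [InnerProductSpace ℝ H] [CompleteSpace H] {Φ : H → ℝ} {z : H} {γ : ℝ → ℝ} {x x' : ℝ → H}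
    {dγ t : ℝ} {a : H} {s : Set ℝ}
    (hΦ : DifferentiableAt ℝ Φ (x t))
    (hγ : HasDerivWithinAt γ dγ s t) (hx : HasDerivWithinAt x (x' t) s t)
    (hx' : HasDerivWithinAt x' a s t)
    (heq : a + γ t • x' t + gradient Φ (x t) = 0) :
    HasDerivWithinAt
      (fun t => t ^ 2 * (Φ (x t) - Φ z) + ‖(2 : ℝ) • (x t - z) + t • x' t‖ ^ 2 / 2
        + (t * γ t - 3) * ‖x t - z‖ ^ 2)
      (2 * t * (Φ (x t) - Φ z + inner ℝ (gradient Φ (x t)) (z - x t))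
        - t * (t * γ t - 3) * ‖x' t‖ ^ 2 + (γ t + t * dγ) * ‖x t - z‖ ^ 2) s t := by
  have hid := hasDerivWithinAt_id t s
  have hΦx : HasDerivWithinAt (fun t => Φ (x t)) (inner ℝ (gradient Φ (x t)) (x' t)) s t := by
    simpa [Function.comp_def] using
      hΦ.hasGradientAt.hasFDerivAt.comp_hasDerivWithinAt t hx
  have hxz := hx.sub_const z
  refine ((((hid.pow 2).mul (hΦx.sub_const (Φ z))).add
    (((hxz.const_smul (2 : ℝ)).add (hid.smul hx')).norm_sq.div_const 2)).add
      (((hid.mul hγ).sub_const 3).mul hxz.norm_sq)).congr_deriv ?_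
  have ha : a = -(γ t • x' t) - gradient Φ (x t) := by
    rw [← sub_eq_zero, ← heq]; abel
  rw [ha]
  obtain ⟨u, hu⟩ : ∃ u, x t - z = u := ⟨_, rfl⟩
  have hu' : z - x t = -u := by rw [← hu]; abel
  simp only [hu, hu', inner_add_left, inner_add_right, inner_sub_right, inner_neg_right,
    real_inner_smul_left, real_inner_smul_right, real_inner_self_eq_norm_sq, id_eq,
    Pi.smul_apply, Pi.smul_apply',
    Pi.pow_apply, Pi.add_apply, Pi.mul_apply,
    real_inner_comm u (gradient Φ (x t)),
    real_inner_comm (x' t) (gradient Φ (x t))]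
  push_cast
  ring

/-- under the general damping hypotheses, `Φ(x(t)) → min Φ` and
`‖x'(t)‖ → 0` as `t → ∞`. -/
theorem stmt_19 {H : Type*} [NormedAddCommGroup H] [InnerProductSpace ℝ H] [CompleteSpace H]
    (Φ : H → ℝ) (hconv : ConvexOn ℝ Set.univ Φ) (hdiff : ContDiff ℝ 1 Φ)
    (t₀ K : ℝ) (ht₀ : 0 < t₀) (hK : 3 < K)
    (xstar : H) (hxstar : ∀ y, Φ xstar ≤ Φ y)
    (γ γ' : ℝ → ℝ)
    (hγ' : ∀ t ∈ Set.Ici t₀, HasDerivWithinAt γ (γ' t) (Set.Ici t₀) t)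
    (hγ'c : ContinuousOn γ' (Set.Ici t₀))
    (hγK : ∀ t ∈ Set.Ici t₀, K / t ≤ γ t)
    (hγint : MeasureTheory.IntegrableOn (fun t => max (γ t + t * γ' t) 0) (Set.Ici t₀))
    (x x' x'' : ℝ → H)
    (hx' : ∀ t ∈ Set.Ici t₀, HasDerivWithinAt x (x' t) (Set.Ici t₀) t)
    (hx'' : ∀ t ∈ Set.Ici t₀, HasDerivWithinAt x' (x'' t) (Set.Ici t₀) t)
    (hx''c : ContinuousOn x'' (Set.Ici t₀))
    (heq : ∀ t ∈ Set.Ici t₀, x'' t + γ t • x' t + gradient Φ (x t) = 0) :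
    Filter.Tendsto (fun t => Φ (x t)) Filter.atTop (nhds (Φ xstar)) ∧
    Filter.Tendsto (fun t => ‖x' t‖) Filter.atTop (nhds 0) := by
  let E : ℝ → ℝ := fun t => t ^ 2 * (Φ (x t) - Φ xstar)
    + ‖(2 : ℝ) • (x t - xstar) + t • x' t‖ ^ 2 / 2 + (t * γ t - 3) * ‖x t - xstar‖ ^ 2
  have hE : ∀ t, E t = t ^ 2 * (Φ (x t) - Φ xstar)
      + ‖(2 : ℝ) • (x t - xstar) + t • x' t‖ ^ 2 / 2 + (t * γ t - 3) * ‖x t - xstar‖ ^ 2 :=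
    fun _ => rfl
  have hdiffΦ : Differentiable ℝ Φ := hdiff.differentiable one_ne_zero
  have hpos : ∀ t ∈ Ici t₀, 0 < t := fun t ht => ht₀.trans_le ht
  have hKγ : ∀ t ∈ Ici t₀, K ≤ t * γ t := fun t ht => by
    have := hγK t ht
    rwa [div_le_iff₀' (hpos t ht)] at this
  have hgap : ∀ y, 0 ≤ Φ y - Φ xstar := fun y => sub_nonneg.mpr (hxstar y)
  have hdist : ∀ t ∈ Ici t₀, (K - 3) * ‖x t - xstar‖ ^ 2 ≤ (t * γ t - 3) * ‖x t - xstar‖ ^ 2 :=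
    fun t ht => by gcongr; exact hKγ t ht
  have hdist_nonneg : ∀ t, 0 ≤ (K - 3) * ‖x t - xstar‖ ^ 2 := fun t =>
    mul_nonneg (sub_pos.mpr hK).le (sq_nonneg _)
  have hγc : ContinuousOn γ (Ici t₀) := fun t ht => (hγ' t ht).continuousWithinAt
  have hbound : ∀ t ∈ Ici t₀, E t ≤
      E t₀ * Real.exp (∫ s in Ici t₀, max (γ s + s * γ' s) 0 / (K - 3)) := by
    refine fun t ht => le_mul_exp_integral_of_hasDerivWithinAt_le
      (fun t ht => hasDerivWithinAt_inertial_energy (hdiffΦ (x t)) (hγ' t ht) (hx' t ht)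
        (hx'' t ht) (heq t ht)) ?_ ?_ (hγint.div_const _) ?_ ?_ ht
    · exact ((hγc.add (continuousOn_id.mul hγ'c)).sup continuousOn_const).div_const _
    · exact fun t _ => div_nonneg (le_max_right _ _) (sub_pos.mpr hK).le
    · intro t ht
      have hconvex := hconv.inner_gradient_le (hdiffΦ (x t)) xstar
      have ht_pos := hpos t ht
      have hpotential : 2 * t * (Φ (x t) - Φ xstar
          + inner ℝ (gradient Φ (x t)) (xstar - x t)) ≤ 0 :=
        mul_nonpos_of_nonneg_of_nonpos (by positivity) (by linarith)
      have hkinetic : 0 ≤ t * (t * γ t - 3) * ‖x' t‖ ^ 2 :=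
        mul_nonneg (mul_nonneg ht_pos.le (by linarith [hKγ t ht])) (sq_nonneg _)
      have hE_ge : (K - 3) * ‖x t - xstar‖ ^ 2 ≤ E t := by
        have := mul_nonneg (sq_nonneg t) (hgap (x t))
        have := sq_nonneg ‖(2 : ℝ) • (x t - xstar) + t • x' t‖
        linarith [hE t, hdist t ht]
      calc _ ≤ (γ t + t * γ' t) * ‖x t - xstar‖ ^ 2 := by linarith
        _ ≤ max (γ t + t * γ' t) 0 * ‖x t - xstar‖ ^ 2 := by gcongr; exact le_max_left _ _
        _ ≤ max (γ t + t * γ' t) 0 * (E t / (K - 3)) := by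
            gcongr
            rwa [le_div_iff₀' (sub_pos.mpr hK)]
        _ = max (γ t + t * γ' t) 0 / (K - 3) * E t := by ring
    · have := mul_nonneg (sq_nonneg t₀) (hgap (x t₀))
      have := hdist t₀ self_mem_Ici
      have := hdist_nonneg t₀
      have := sq_nonneg ‖(2 : ℝ) • (x t₀ - xstar) + t₀ • x' t₀‖
      linarith
  obtain ⟨C, hC⟩ : ∃ C, ∀ t ∈ Ici t₀, E t ≤ C := ⟨_, hbound⟩
  have hinv : Tendsto (fun t : ℝ => (t ^ 2)⁻¹) atTop (nhds 0) :=
    (tendsto_pow_atTop two_ne_zero).inv_tendsto_atTop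
  constructor
  · rw [← tendsto_sub_nhds_zero_iff]
    refine squeeze_zero' (.of_forall fun t => hgap (x t)) ?_ (by simpa using hinv.const_mul C)
    filter_upwards [Ici_mem_atTop t₀] with t ht
    have ht_pos := hpos t ht
    rw [← div_eq_mul_inv, le_div_iff₀' (by positivity)]
    have := sq_nonneg ‖(2 : ℝ) • (x t - xstar) + t • x' t‖
    linarith [hE t, hC t ht, hdist t ht, hdist_nonneg t]
  · suffices hsq : Tendsto (fun t => ‖x' t‖ ^ 2) atTop (nhds 0) by
      simpa using hsq.sqrt
    refine squeeze_zero' (.of_forall fun t => sq_nonneg _) ?_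
      (by simpa using hinv.const_mul (4 * C + 8 * (C / (K - 3))))
    filter_upwards [Ici_mem_atTop t₀] with t ht
    have ht_pos := hpos t ht
    rw [← div_eq_mul_inv, le_div_iff₀' (by positivity)]
    have hW := mul_nonneg (sq_nonneg t) (hgap (x t))
    have hv := sq_nonneg ‖(2 : ℝ) • (x t - xstar) + t • x' t‖
    have hd : ‖x t - xstar‖ ^ 2 ≤ C / (K - 3) := by
      rw [le_div_iff₀' (sub_pos.mpr hK)]
      linarith [hE t, hC t ht, hdist t ht]
    have htri := norm_sub_le ((2 : ℝ) • (x t - xstar) + t • x' t) ((2 : ℝ) • (x t - xstar))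
    rw [add_sub_cancel_left, norm_smul, norm_smul, Real.norm_of_nonneg ht_pos.le,
      Real.norm_of_nonneg zero_le_two] at htri
    have hsq : (t * ‖x' t‖) ^ 2 ≤
        2 * (‖(2 : ℝ) • (x t - xstar) + t • x' t‖ ^ 2 + (2 * ‖x t - xstar‖) ^ 2) :=
      (pow_le_pow_left₀ (by positivity) htri 2).trans add_sq_le
    rw [mul_pow, mul_pow] at hsq
    linarith [hE t, hC t ht, hdist t ht, hdist_nonneg t]
end
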